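/- Let (t_k)_{k≥0} satisfy condition (T), let 0 < s < 1/L, and let (x_k) be generated by (TIREPROG). Let k₀ ∈ ℕ be such that s ≤ 1/(L + ε_{k₀}), and set α_k = (−t_k² + t_k + t_{k−1}²)/t_{k−1}² and π_k = 1/∏_{i=k₀}^{k}(1 − α_i). Assume that (π_k) converges to a finite limit, that ∑_{k≥1} t_k²(ε_k − ε_{k+1}) < +∞, and that ∑_{k≥1} t_k ε_k < +∞. Then there exist C₁, C₂ > 0 and K ∈ ℕ such that for all k ≥ K: F_k(x_k) − F_k(x̄_k) ≤ C₁/t_{k−1}², and (f+g)(x_k) − min(f+g) ≤ C₁/t_{k−1}² + C₂ ε_k. -/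

import Mathlib

open Filter Topology
open scoped RealInnerProductSpace

section Auxiliary

variable {H : Type*} [NormedAddCommGroup H] [InnerProductSpace ℝ H]

theorem hasDerivAt_comp_segment [CompleteSpace H] {g : H → ℝ} {g' : H → H}
    (hd : ∀ u, HasGradientAt g (g' u) u) (u v : H) (τ : ℝ) :
    HasDerivAt (fun τ : ℝ => g (u + τ • (v - u))) ⟪g' (u + τ • (v - u)), v - u⟫ τ := by
  have hline : HasDerivAt (fun τ : ℝ => u + τ • (v - u)) (v - u) τ := by
    simpa using ((hasDerivAt_id τ).smul_const (v - u)).const_add u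
  have h := (hd (u + τ • (v - u))).hasFDerivAt.comp_hasDerivAt τ hline
  rw [InnerProductSpace.toDual_apply_apply] at h
  exact h

/-- A convex function lies above its tangent hyperplanes. -/
theorem gradient_ineq_of_convexOn [CompleteSpace H] {g : H → ℝ} {g' : H → H}
    (hg : ConvexOn ℝ Set.univ g) (hd : ∀ u, HasGradientAt g (g' u) u) (u v : H) :
    g u + ⟪g' u, v - u⟫ ≤ g v := by
  have hderiv : HasDerivAt (fun τ : ℝ => g (u + τ • (v - u))) ⟪g' u, v - u⟫ 0 := by
    simpa using hasDerivAt_comp_segment hd u v 0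
  have hconv : ConvexOn ℝ Set.univ (fun τ : ℝ => g (u + τ • (v - u))) := by
    refine ⟨convex_univ, fun a _ b _ p q hp hq hpq => ?_⟩
    have h := hg.2 (Set.mem_univ (u + a • (v - u))) (Set.mem_univ (u + b • (v - u))) hp hq hpq
    have e : p • (u + a • (v - u)) + q • (u + b • (v - u))
        = u + (p • a + q • b) • (v - u) := by
      have hp' : p = 1 - q := by linarith
      subst hp'
      simp only [smul_eq_mul]
      module
    simpa only [e] using h
  have h := hconv.le_slope_of_hasDerivAt (Set.mem_univ 0) (Set.mem_univ 1) one_pos hderiv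
  simp [slope_def_field] at h
  linarith

/-- The descent lemma for a function with Lipschitz gradient. -/
theorem descent_of_lipschitz_gradient [CompleteSpace H] {g : H → ℝ} {g' : H → H} {L : ℝ}
    (hd : ∀ u, HasGradientAt g (g' u) u) (hlip : ∀ u v, ‖g' u - g' v‖ ≤ L * ‖u - v‖) (u v : H) :
    g v ≤ g u + ⟪g' u, v - u⟫ + L / 2 * ‖v - u‖ ^ 2 := by
  have hderiv : ∀ τ : ℝ, HasDerivAt
      (fun τ : ℝ => g (u + τ • (v - u)) - (τ * ⟪g' u, v - u⟫ + τ ^ 2 * (L / 2 * ‖v - u‖ ^ 2)))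
      (⟪g' (u + τ • (v - u)), v - u⟫ - (⟪g' u, v - u⟫ + 2 * τ * (L / 2 * ‖v - u‖ ^ 2))) τ := by
    intro τ
    have h1 : HasDerivAt (fun τ : ℝ => g (u + τ • (v - u)))
        ⟪g' (u + τ • (v - u)), v - u⟫ τ := hasDerivAt_comp_segment hd u v τ
    have h2 : HasDerivAt (fun τ : ℝ => τ * ⟪g' u, v - u⟫) ⟪g' u, v - u⟫ τ := by
      simpa using (hasDerivAt_id τ).mul_const ⟪g' u, v - u⟫
    have h3 : HasDerivAt (fun τ : ℝ => τ ^ 2 * (L / 2 * ‖v - u‖ ^ 2))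
        (2 * τ * (L / 2 * ‖v - u‖ ^ 2)) τ := by
      simpa using (hasDerivAt_pow 2 τ).mul_const (L / 2 * ‖v - u‖ ^ 2)
    exact h1.sub (h2.add h3)
  have hanti := antitoneOn_of_deriv_nonpos (convex_Icc (0 : ℝ) 1)
    (fun τ _ => (hderiv τ).continuousAt.continuousWithinAt)
    (fun τ _ => (hderiv τ).differentiableAt.differentiableWithinAt)
    (fun τ hτ => by
      rw [interior_Icc] at hτ
      rw [(hderiv τ).deriv]
      have h1 : ⟪g' (u + τ • (v - u)) - g' u, v - u⟫ ≤ L * τ * ‖v - u‖ ^ 2 := by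
        calc ⟪g' (u + τ • (v - u)) - g' u, v - u⟫
            ≤ ‖g' (u + τ • (v - u)) - g' u‖ * ‖v - u‖ := real_inner_le_norm _ _
          _ ≤ (L * ‖u + τ • (v - u) - u‖) * ‖v - u‖ := by
              gcongr
              exact hlip _ _
          _ = L * τ * ‖v - u‖ ^ 2 := by
              rw [add_sub_cancel_left, norm_smul, Real.norm_of_nonneg hτ.1.le]
              ring
      rw [inner_sub_left] at h1
      linarith)
  have h := hanti (Set.left_mem_Icc.2 zero_le_one) (Set.right_mem_Icc.2 zero_le_one) zero_le_one
  simp at h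
  linarith

theorem norm_sq_convexCombination {a b : ℝ} (hab : a + b = 1) (u v : H) :
    ‖a • u + b • v‖ ^ 2 = a * ‖u‖ ^ 2 + b * ‖v‖ ^ 2 - a * b * ‖u - v‖ ^ 2 := by
  obtain rfl : a = 1 - b := by linarith
  rw [norm_add_sq_real, norm_sub_sq_real, norm_smul, norm_smul, inner_smul_left, inner_smul_right,
    mul_pow, mul_pow, Real.norm_eq_abs, Real.norm_eq_abs, sq_abs, sq_abs]
  simp only [conj_trivial]
  ring

/-- The three-point inequality for a proximal point `p` of `φ` at `z`. -/
theorem prox_three_point {D : Set H} {φ : H → ℝ} (hφ : ConvexOn ℝ D φ) {s : ℝ} {z p : H}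
    (hp : p ∈ D) (hmin : ∀ u ∈ D, φ p + ‖p - z‖ ^ 2 / (2 * s) ≤ φ u + ‖u - z‖ ^ 2 / (2 * s))
    {u : H} (hu : u ∈ D) :
    φ p + ‖p - z‖ ^ 2 / (2 * s) + ‖p - u‖ ^ 2 / (2 * s) ≤ φ u + ‖u - z‖ ^ 2 / (2 * s) := by
  have key : ∀ τ ∈ Set.Ioo (0 : ℝ) 1,
      φ p + ‖p - z‖ ^ 2 / (2 * s) + (1 - τ) * (‖p - u‖ ^ 2 / (2 * s))
        ≤ φ u + ‖u - z‖ ^ 2 / (2 * s) := by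
    rintro τ ⟨h0, h1⟩
    have hsum : (1 - τ) + τ = 1 := by ring
    have hm := hmin _ (hφ.1 hp hu (sub_nonneg.2 h1.le) h0.le hsum)
    have hc := hφ.2 hp hu (sub_nonneg.2 h1.le) h0.le hsum
    have e : (1 - τ) • p + τ • u - z = (1 - τ) • (p - z) + τ • (u - z) := by module
    rw [e, norm_sq_convexCombination hsum, sub_sub_sub_cancel_right] at hm
    simp only [smul_eq_mul] at hc
    refine le_of_mul_le_mul_left ?_ h0
    have e' : ((1 - τ) * ‖p - z‖ ^ 2 + τ * ‖u - z‖ ^ 2 - (1 - τ) * τ * ‖p - u‖ ^ 2) / (2 * s)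
        = (1 - τ) * (‖p - z‖ ^ 2 / (2 * s)) + τ * (‖u - z‖ ^ 2 / (2 * s))
          - (1 - τ) * τ * (‖p - u‖ ^ 2 / (2 * s)) := by ring
    rw [e'] at hm
    linarith
  have hlim : Tendsto
      (fun τ : ℝ => φ p + ‖p - z‖ ^ 2 / (2 * s) + (1 - τ) * (‖p - u‖ ^ 2 / (2 * s)))
      (𝓝[>] 0) (𝓝 (φ p + ‖p - z‖ ^ 2 / (2 * s) + (1 - 0) * (‖p - u‖ ^ 2 / (2 * s)))) := by
    refine Tendsto.mono_left (Continuous.tendsto ?_ 0) nhdsWithin_le_nhds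
    fun_prop
  have h := le_of_tendsto hlim (eventually_of_mem (Ioo_mem_nhdsGT one_pos) key)
  simpa using h

/-- The fundamental inequality of a proximal gradient step from `y` to `p` for the function
`φ + g + (e / 2) ‖·‖²`. -/
theorem proximal_gradient_step [CompleteSpace H] {D : Set H} {φ g : H → ℝ} {g' : H → H} {L : ℝ}
    (hφ : ConvexOn ℝ D φ) (hg : ConvexOn ℝ Set.univ g) (hd : ∀ u, HasGradientAt g (g' u) u)
    (hlip : ∀ u v, ‖g' u - g' v‖ ≤ L * ‖u - v‖) {s e : ℝ} (hs : 0 < s) (he : 0 ≤ e)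
    (hse : s * (L + e) ≤ 1) {y p : H} (hp : p ∈ D)
    (hmin : ∀ u ∈ D, φ p + ‖p - (y - s • g' y - (s * e) • y)‖ ^ 2 / (2 * s)
      ≤ φ u + ‖u - (y - s • g' y - (s * e) • y)‖ ^ 2 / (2 * s))
    {u : H} (hu : u ∈ D) :
    φ p + g p + e / 2 * ‖p‖ ^ 2 + ‖p - u‖ ^ 2 / (2 * s)
      ≤ φ u + g u + e / 2 * ‖u‖ ^ 2 + ‖y - u‖ ^ 2 / (2 * s) := by
  have h3 := prox_three_point hφ hp hmin hu
  have hexp : ∀ w : H, ‖w - (y - s • g' y - (s * e) • y)‖ ^ 2 / (2 * s)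
      = ‖w - y‖ ^ 2 / (2 * s) + ⟪g' y, w - y⟫ + e * ⟪y, w - y⟫
        + s / 2 * ‖g' y + e • y‖ ^ 2 := by
    intro w
    have e1 : w - (y - s • g' y - (s * e) • y) = (w - y) + s • (g' y + e • y) := by module
    rw [e1, norm_add_sq_real, inner_smul_right, norm_smul, mul_pow, Real.norm_eq_abs, sq_abs,
      inner_add_right, inner_smul_right, real_inner_comm (g' y), real_inner_comm y]
    field_simp
    ring
  have hsq : ∀ w : H, ‖w‖ ^ 2 = ‖y‖ ^ 2 + 2 * ⟪y, w - y⟫ + ‖w - y‖ ^ 2 := by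
    intro w
    rw [← norm_add_sq_real, add_sub_cancel]
  rw [hexp, hexp] at h3
  have hdesc := descent_of_lipschitz_gradient hd hlip y p
  have hgrad := gradient_ineq_of_convexOn hg hd y u
  have hstep : (L + e) / 2 * ‖p - y‖ ^ 2 ≤ ‖p - y‖ ^ 2 / (2 * s) := by
    rw [le_div_iff₀ (by positivity)]
    nlinarith [mul_le_mul_of_nonneg_right hse (sq_nonneg ‖p - y‖)]
  have heu : 0 ≤ e / 2 * ‖u - y‖ ^ 2 := by positivity
  rw [hsq p, hsq u, norm_sub_rev y u]
  linarith

/-- One step of the energy decrease of the scaled proximal gradient method. -/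
theorem energy_step [CompleteSpace H] {D : Set H} {φ g : H → ℝ} {g' : H → H} {L : ℝ}
    (hφ : ConvexOn ℝ D φ) (hg : ConvexOn ℝ Set.univ g) (hd : ∀ u, HasGradientAt g (g' u) u)
    (hlip : ∀ u v, ‖g' u - g' v‖ ≤ L * ‖u - v‖) {s e : ℝ} (hs : 0 < s) (he : 0 ≤ e)
    (hse : s * (L + e) ≤ 1) {y x p q z : H} (hp : p ∈ D) (hx : x ∈ D) (hq : q ∈ D)
    (hmin : ∀ u ∈ D, φ p + ‖p - (y - s • g' y - (s * e) • y)‖ ^ 2 / (2 * s)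
      ≤ φ u + ‖u - (y - s • g' y - (s * e) • y)‖ ^ 2 / (2 * s))
    {t β : ℝ} (ht : 1 ≤ t) (hβ0 : 0 ≤ β) (hβ1 : β ≤ 1)
    (hy : t • y - (t - 1) • x = β • z) :
    t ^ 2 * ((φ p + g p + e / 2 * ‖p‖ ^ 2) - (φ q + g q + e / 2 * ‖q‖ ^ 2))
        + ‖t • p - (t - 1) • x - q‖ ^ 2 / (2 * s)
      ≤ (t ^ 2 - t) * ((φ x + g x + e / 2 * ‖x‖ ^ 2) - (φ q + g q + e / 2 * ‖q‖ ^ 2))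
        + β * (‖z - q‖ ^ 2 / (2 * s)) + (1 - β) * (‖q‖ ^ 2 / (2 * s)) := by
  have ht0 : 0 < t := by linarith
  have ha : 0 ≤ 1 - 1 / t := sub_nonneg.2 ((div_le_one ht0).2 ht)
  have hb : 0 ≤ 1 / t := by positivity
  have hab : 1 - 1 / t + 1 / t = 1 := by ring
  set u := (1 - 1 / t) • x + (1 / t) • q with hu
  have huD : u ∈ D := hφ.1 hx hq ha hb hab
  have hstep := proximal_gradient_step hφ hg hd hlip hs he hse hp hmin huD
  have h1 := hφ.2 hx hq ha hb hab
  have h2 := hg.2 (Set.mem_univ x) (Set.mem_univ q) ha hb hab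
  have h3 := norm_sq_convexCombination hab x q
  rw [← hu] at h1 h2 h3
  simp only [smul_eq_mul] at h1 h2
  have htu : t • u = (t - 1) • x + q := by
    rw [hu, smul_add, smul_smul, smul_smul, mul_sub, mul_one_div_cancel ht0.ne', mul_one, one_smul]
  have hscale : ∀ w : H, ‖t • w - (t - 1) • x - q‖ ^ 2 = t ^ 2 * ‖w - u‖ ^ 2 := by
    intro w
    rw [sub_sub, ← htu, ← smul_sub, norm_smul, mul_pow, Real.norm_eq_abs, sq_abs]
  have hz : t ^ 2 * ‖y - u‖ ^ 2 ≤ β * ‖z - q‖ ^ 2 + (1 - β) * ‖q‖ ^ 2 := by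
    have e1 : β • z - q = β • (z - q) + (1 - β) • (-q) := by module
    rw [← hscale, hy, e1, norm_sq_convexCombination (by ring), norm_neg]
    have : 0 ≤ β * (1 - β) * ‖z - q - -q‖ ^ 2 :=
      mul_nonneg (mul_nonneg hβ0 (sub_nonneg.2 hβ1)) (sq_nonneg _)
    linarith
  have hz' : t ^ 2 * (‖y - u‖ ^ 2 / (2 * s))
      ≤ β * (‖z - q‖ ^ 2 / (2 * s)) + (1 - β) * (‖q‖ ^ 2 / (2 * s)) := by
    have := div_le_div_of_nonneg_right hz (by positivity : 0 ≤ 2 * s)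
    calc _ = t ^ 2 * ‖y - u‖ ^ 2 / (2 * s) := by ring
      _ ≤ _ := this
      _ = _ := by ring
  have hsq : e / 2 * ‖u‖ ^ 2
      ≤ (1 - 1 / t) * (e / 2 * ‖x‖ ^ 2) + 1 / t * (e / 2 * ‖q‖ ^ 2) := by
    have : 0 ≤ e / 2 * ((1 - 1 / t) * (1 / t) * ‖x - q‖ ^ 2) := by positivity
    rw [h3]
    linarith
  have hF : φ u + g u + e / 2 * ‖u‖ ^ 2 ≤ (1 - 1 / t) * (φ x + g x + e / 2 * ‖x‖ ^ 2)
      + 1 / t * (φ q + g q + e / 2 * ‖q‖ ^ 2) := by linarith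
  have hF' := mul_le_mul_of_nonneg_left hF (sq_nonneg t)
  have e2 : t ^ 2 * ((1 - 1 / t) * (φ x + g x + e / 2 * ‖x‖ ^ 2)
      + 1 / t * (φ q + g q + e / 2 * ‖q‖ ^ 2))
      = (t ^ 2 - t) * (φ x + g x + e / 2 * ‖x‖ ^ 2) + t * (φ q + g q + e / 2 * ‖q‖ ^ 2) := by
    field_simp
  rw [e2] at hF'
  have hstep' := mul_le_mul_of_nonneg_left hstep (sq_nonneg t)
  rw [hscale p, mul_div_assoc]
  linarith

end Auxiliary

/-- A sequence contracted towards a constant up to a summable error is bounded above. -/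
theorem bddAbove_of_contraction_add_summable {a β b : ℕ → ℝ} {c : ℝ} {N : ℕ} (hb : Summable b)
    (hβ0 : ∀ n ≥ N, 0 ≤ β n) (hβ1 : ∀ n ≥ N, β n ≤ 1)
    (h : ∀ n ≥ N, a (n + 1) ≤ β n * a n + (1 - β n) * c + b n) :
    ∃ M, ∀ n ≥ N, a n ≤ M := by
  have hbd : ∀ n ≥ N, a n ≤ max (a N) c + ∑ i ∈ Finset.range n, |b i| := by
    intro n hn
    induction n, hn using Nat.le_induction with
    | base =>
      have : 0 ≤ ∑ i ∈ Finset.range N, |b i| := Finset.sum_nonneg fun i _ => abs_nonneg _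
      linarith [le_max_left (a N) c]
    | succ n hn ih =>
      have hS : 0 ≤ ∑ i ∈ Finset.range n, |b i| := Finset.sum_nonneg fun i _ => abs_nonneg _
      rw [Finset.sum_range_succ]
      have h1 := mul_le_mul_of_nonneg_left ih (hβ0 n hn)
      have h2 := mul_le_mul_of_nonneg_left (le_max_right (a N) c) (sub_nonneg.2 (hβ1 n hn))
      have h3 := mul_le_mul_of_nonneg_right (hβ1 n hn) hS
      linarith [h n hn, le_abs_self (b n)]
  refine ⟨max (a N) c + ∑' i, |b i|, fun n hn => (hbd n hn).trans ?_⟩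
  gcongr
  exact hb.abs.sum_le_tsum _ fun i _ => abs_nonneg _

/-- If `w` is nondecreasing, `ε` decreases to `0` and `∑ w k (ε k - ε (k + 1))` converges, then
`w k * ε k` is bounded. -/
theorem mul_bounded_of_summable_mul_sub {w ε : ℕ → ℝ} (hw : Monotone w)
    (hε : ∀ k, 1 ≤ k → ε (k + 1) ≤ ε k) (hlim : Tendsto ε atTop (𝓝 0))
    (hsum : Summable fun k => w k * (ε k - ε (k + 1))) :
    ∃ S, 0 ≤ S ∧ ∀ k, 1 ≤ k → w k * ε k ≤ S := by
  refine ⟨∑' k, |w k * (ε k - ε (k + 1))|, tsum_nonneg fun _ => abs_nonneg _, fun k hk => ?_⟩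
  have hpart : ∀ n ≥ k, w k * (ε k - ε n) ≤ ∑ i ∈ Finset.range n, |w i * (ε i - ε (i + 1))| := by
    intro n hn
    induction n, hn using Nat.le_induction with
    | base =>
      rw [sub_self, mul_zero]
      exact Finset.sum_nonneg fun i _ => abs_nonneg _
    | succ n hn ih =>
      rw [Finset.sum_range_succ]
      have h1 := mul_le_mul_of_nonneg_right (hw hn) (sub_nonneg.2 (hε n (hk.trans hn)))
      linarith [le_abs_self (w n * (ε n - ε (n + 1)))]
  have hl : Tendsto (fun n => w k * (ε k - ε n)) atTop (𝓝 (w k * (ε k - 0))) :=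
    (tendsto_const_nhds.sub hlim).const_mul _
  rw [sub_zero] at hl
  refine le_of_tendsto hl (eventually_atTop.2 ⟨k, fun n hn => (hpart n hn).trans ?_⟩)
  exact hsum.abs.sum_le_tsum _ fun i _ => abs_nonneg _

theorem tireprog_optimal_rate_pi_finite
    {H : Type*} [NormedAddCommGroup H] [InnerProductSpace ℝ H] [CompleteSpace H]
    (f : H → EReal) (g : H → ℝ) (g' : H → H) (L : ℝ) (hL : 0 < L)
    -- f is proper, convex and lower semicontinuous
    (hf_proper : ∃ z, f z ≠ ⊤) (hf_nebot : ∀ z, f z ≠ ⊥)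
    (hf_convex : ∀ u v : H, ∀ a b : ℝ, 0 ≤ a → 0 ≤ b → a + b = 1 →
      f (a • u + b • v) ≤ (a : EReal) * f u + (b : EReal) * f v)
    (hf_lsc : LowerSemicontinuous f)
    -- g is convex, differentiable with L-Lipschitz gradient g'
    (hg_convex : ConvexOn ℝ Set.univ g)
    (hg_diff : ∀ u : H, HasGradientAt g (g' u) u)
    (hg_lip : ∀ u v : H, ‖g' u - g' v‖ ≤ L * ‖u - v‖)
    -- prox_{σ f} is a minimizer of u ↦ f(u) + ‖u − z‖²/(2σ)
    (prox : ℝ → H → H)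
    (hprox : ∀ σ : ℝ, 0 < σ → ∀ z u : H,
      f (prox σ z) + ((‖prox σ z - z‖ ^ 2 / (2 * σ) : ℝ) : EReal)
        ≤ f u + ((‖u - z‖ ^ 2 / (2 * σ) : ℝ) : EReal))
    -- the sequence (t_k) satisfies condition (T)
    (t : ℕ → ℝ) (ht0 : t 0 = 1)
    (hT : ∀ k : ℕ, 1 ≤ k →
      t (k - 1) < t k ∧ t k < (1 + Real.sqrt (1 + 4 * t (k - 1) ^ 2)) / 2)
    -- (ε_k) is a nonincreasing sequence of positive reals tending to 0
    (ε : ℕ → ℝ) (hε_pos : ∀ k : ℕ, 1 ≤ k → 0 < ε k)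
    (hε_anti : ∀ k : ℕ, 1 ≤ k → ε (k + 1) ≤ ε k)
    (hε_lim : Tendsto ε atTop (nhds (0 : ℝ)))
    -- the stepsize
    (s : ℝ) (hs_pos : 0 < s) (hs_lt : s < 1 / L)
    -- the algorithm (TIREPROG)
    (x y : ℕ → H)
    (hy : ∀ k : ℕ, 1 ≤ k → y k = x k
        + (((t k - 1) * (t (k - 1) - 1)) / (t (k - 1)) ^ 2) • (x k - x (k - 1))
        - (((-(t k) ^ 2 + t k + (t (k - 1)) ^ 2) / ((t (k - 1)) ^ 2 * t k))) • x k)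
    (hx : ∀ k : ℕ, 1 ≤ k →
      x (k + 1) = prox s (y k - s • g' (y k) - (s * ε k) • y k))
    -- α_k and π_k
    (k₀ : ℕ) (hk₀ : s ≤ 1 / (L + ε k₀))
    (α π : ℕ → ℝ)
    (hα : ∀ k : ℕ, 1 ≤ k → α k = (-(t k) ^ 2 + t k + (t (k - 1)) ^ 2) / (t (k - 1)) ^ 2)
    (hπ : ∀ k : ℕ, k₀ ≤ k → π k = 1 / ∏ i ∈ Finset.Icc k₀ k, (1 - α i))
    -- hypotheses (b)
    (hπ_fin : ∃ l : ℝ, Tendsto π atTop (nhds l))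
    (hsum1 : Summable (fun k : ℕ => (t k) ^ 2 * (ε k - ε (k + 1))))
    (hsum2 : Summable (fun k : ℕ => t k * ε k))
    -- F_k(x) = f(x) + g(x) + (ε_k/2)‖x‖² and its unique minimizer x̄_k
    (F : ℕ → H → EReal)
    (hF : ∀ (k : ℕ) (u : H), F k u = f u + (g u : EReal) + ((ε k / 2 * ‖u‖ ^ 2 : ℝ) : EReal))
    (xbar : ℕ → H)
    (hxbar : ∀ (k : ℕ) (u : H), F k (xbar k) ≤ F k u)
    -- a (global) minimizer of f + g, so that (f+g)(xmin) = min (f+g)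
    (xmin : H)
    (hxmin : ∀ u : H, f xmin + (g xmin : EReal) ≤ f u + (g u : EReal))
 :
    ∃ C₁ C₂ : ℝ, 0 < C₁ ∧ 0 < C₂ ∧ ∃ K : ℕ, ∀ k : ℕ, K ≤ k →
      F k (x k) ≤ F k (xbar k) + ((C₁ / (t (k - 1)) ^ 2 : ℝ) : EReal) ∧
      f (x k) + (g (x k) : EReal)
        ≤ f xmin + (g xmin : EReal) + ((C₁ / (t (k - 1)) ^ 2 + C₂ * ε k : ℝ) : EReal) := by
  set D : Set H := {u | f u ≠ ⊤}
  set φ : H → ℝ := fun u => (f u).toReal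
  have hφ : ∀ u ∈ D, f u = (φ u : EReal) := fun u hu =>
    (EReal.coe_toReal hu (hf_nebot u)).symm
  have htop : ∀ (u : H) (r : ℝ) (c : EReal), c < ⊤ → f u + (r : EReal) ≤ c → u ∈ D := by
    intro u r c hc h hu
    rw [hu, EReal.top_add_coe] at h
    exact absurd hc (not_lt.2 h)
  have hconv : ConvexOn ℝ D φ := by
    have key : ∀ u ∈ D, ∀ v ∈ D, ∀ a b : ℝ, 0 ≤ a → 0 ≤ b → a + b = 1 →
        f (a • u + b • v) ≤ ((a * φ u + b * φ v : ℝ) : EReal) := by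
      intro u hu v hv a b ha hb hab
      have h := hf_convex u v a b ha hb hab
      rw [hφ u hu, hφ v hv] at h
      exact_mod_cast h
    have hmem : ∀ u ∈ D, ∀ v ∈ D, ∀ a b : ℝ, 0 ≤ a → 0 ≤ b → a + b = 1 →
        a • u + b • v ∈ D := fun u hu v hv a b ha hb hab =>
      ((key u hu v hv a b ha hb hab).trans_lt (EReal.coe_lt_top _)).ne
    refine ⟨fun u hu v hv a b ha hb hab => hmem u hu v hv a b ha hb hab,
      fun u hu v hv a b ha hb hab => ?_⟩
    have h := key u hu v hv a b ha hb hab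
    rw [hφ _ (hmem u hu v hv a b ha hb hab)] at h
    exact EReal.coe_le_coe_iff.1 h
  obtain ⟨z₀, hz₀⟩ := hf_proper
  have hz₀D : z₀ ∈ D := hz₀
  have hqD : xmin ∈ D := by
    refine htop xmin (g xmin) _ ?_ (hxmin z₀)
    rw [hφ z₀ hz₀D]
    exact_mod_cast EReal.coe_lt_top _
  have hproxD : ∀ z : H, prox s z ∈ D := by
    intro z
    refine htop _ _ _ ?_ (hprox s hs_pos z z₀)
    rw [hφ z₀ hz₀D]
    exact_mod_cast EReal.coe_lt_top _
  have hproxmin : ∀ z : H, ∀ u ∈ D, φ (prox s z) + ‖prox s z - z‖ ^ 2 / (2 * s)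
      ≤ φ u + ‖u - z‖ ^ 2 / (2 * s) := by
    intro z u hu
    have h := hprox s hs_pos z u
    rw [hφ _ (hproxD z), hφ u hu] at h
    exact_mod_cast h
  have hFreal : ∀ k, ∀ u ∈ D, F k u = ((φ u + g u + ε k / 2 * ‖u‖ ^ 2 : ℝ) : EReal) := by
    intro k u hu
    rw [hF, hφ u hu]
    norm_cast
  have hbarD : ∀ k, xbar k ∈ D := by
    intro k
    refine htop _ (g (xbar k) + ε k / 2 * ‖xbar k‖ ^ 2) (F k xmin) ?_ ?_
    · rw [hFreal k xmin hqD]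
      exact EReal.coe_lt_top _
    · have h := hxbar k xmin
      rwa [hF k (xbar k), add_assoc, ← EReal.coe_add] at h
  have hxD : ∀ k, 2 ≤ k → x k ∈ D := by
    intro k hk
    obtain ⟨m, rfl⟩ : ∃ m, k = m + 1 := ⟨k - 1, by omega⟩
    rw [hx m (by omega)]
    exact hproxD _
  have htsucc : ∀ k, t k < t (k + 1) := fun k => (hT (k + 1) (by omega)).1
  have htmono : StrictMono t := strictMono_nat_of_lt_succ htsucc
  have ht1 : ∀ k, 1 ≤ t k := fun k => ht0 ▸ htmono.monotone (Nat.zero_le k)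
  have htquad : ∀ k, t (k + 1) ^ 2 - t (k + 1) ≤ t k ^ 2 := by
    intro k
    have h := (hT (k + 1) (by omega)).2
    simp only [Nat.add_sub_cancel] at h
    have hsq := Real.sq_sqrt (by positivity : (0 : ℝ) ≤ 1 + 4 * t k ^ 2)
    have h1 : 2 * t (k + 1) - 1 ≤ Real.sqrt (1 + 4 * t k ^ 2) := by linarith
    have h2 := pow_le_pow_left₀ (by linarith [ht1 (k + 1)]) h1 2
    rw [hsq] at h2
    linarith
  obtain ⟨S, hS0, hS⟩ := mul_bounded_of_summable_mul_sub (w := fun k => t k ^ 2)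
    (fun i j hij => pow_le_pow_left₀ (by linarith [ht1 i]) (htmono.monotone hij) 2)
    hε_anti hε_lim hsum1
  have hstepsize : ∀ᶠ k in atTop, s * (L + ε k) ≤ 1 := by
    have hl : Tendsto (fun k => s * (L + ε k)) atTop (𝓝 (s * (L + 0))) :=
      (tendsto_const_nhds.add hε_lim).const_mul _
    refine hl.eventually_le_const ?_
    rw [add_zero]
    exact (lt_div_iff₀ hL).1 hs_lt
  obtain ⟨N₀, hN₀⟩ := eventually_atTop.1 hstepsize
  set N := N₀ + 2
  let Φ : ℕ → H → ℝ := fun k u => φ u + g u + ε k / 2 * ‖u‖ ^ 2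
  let z : ℕ → H := fun k => t (k - 1) • x k - (t (k - 1) - 1) • x (k - 1)
  let E : ℕ → ℝ := fun k => t (k - 1) ^ 2 * (Φ k (x k) - Φ k xmin)
    + ‖z k - xmin‖ ^ 2 / (2 * s)
  let β : ℕ → ℝ := fun k => (t k ^ 2 - t k) / t (k - 1) ^ 2
  have htpos : ∀ k, 0 < t k := fun k => by linarith [ht1 k]
  have hβ0 : ∀ k, 0 ≤ β k := fun k =>
    div_nonneg (by nlinarith [ht1 k]) (sq_nonneg _)
  have hβ1 : ∀ k ≥ N, β k ≤ 1 := by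
    intro k hk
    obtain ⟨m, rfl⟩ : ∃ m, k = m + 1 := ⟨k - 1, by omega⟩
    exact (div_le_one (pow_pos (htpos _) 2)).2 (htquad m)
  have hstep : ∀ k ≥ N, E (k + 1) ≤ β k * E k + (1 - β k) * (‖xmin‖ ^ 2 / (2 * s))
      + t k ^ 2 * (ε k - ε (k + 1)) * (‖xmin‖ ^ 2 / 2) := by
    intro k hk
    have hk1 : 1 ≤ k := by omega
    have hyz : t k • y k - (t k - 1) • x k = β k • z k := by
      have h1 := (htpos k).ne'
      have h2 := (htpos (k - 1)).ne'
      rw [hy k hk1]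
      simp only [β, z]
      match_scalars <;> field_simp <;> ring
    have h := energy_step hconv hg_convex hg_diff hg_lip hs_pos (hε_pos k hk1).le
      (hN₀ k (by omega)) (hproxD (y k - s • g' (y k) - (s * ε k) • y k))
      (hxD k (by omega)) hqD (hproxmin _) (ht1 k) (hβ0 k) (hβ1 k hk) hyz
    rw [← hx k hk1] at h
    have hβt : t k ^ 2 - t k = β k * t (k - 1) ^ 2 :=
      (div_mul_cancel₀ _ (pow_pos (htpos (k - 1)) 2).ne').symm
    rw [hβt] at h
    have hdrop : 0 ≤ t k ^ 2 * (ε k - ε (k + 1)) * (‖x (k + 1)‖ ^ 2 / 2) :=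
      mul_nonneg (mul_nonneg (sq_nonneg _) (sub_nonneg.2 (hε_anti k hk1))) (by positivity)
    simp only [E, Φ, z, Nat.add_sub_cancel]
    linarith
  obtain ⟨M, hM⟩ := bddAbove_of_contraction_add_summable (hsum1.mul_right (‖xmin‖ ^ 2 / 2))
    (fun k _ => hβ0 k) hβ1 hstep
  have hrate : ∀ k ≥ N, Φ k (x k)
      ≤ Φ k (xbar k) + (|M| + S * (‖xmin‖ ^ 2 / 2) + 1) / t (k - 1) ^ 2 := by
    intro k hk
    have hk1 : 1 ≤ k := by omega
    have hmin : φ xmin + g xmin ≤ φ (xbar k) + g (xbar k) := by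
      have h := hxmin (xbar k)
      rw [hφ _ hqD, hφ _ (hbarD k)] at h
      exact_mod_cast h
    have hεk := hε_pos k hk1
    have hgap : Φ k xmin - Φ k (xbar k) ≤ ε k * (‖xmin‖ ^ 2 / 2) := by
      have : 0 ≤ ε k / 2 * ‖xbar k‖ ^ 2 := by positivity
      simp only [Φ]
      linarith
    have hEk : t (k - 1) ^ 2 * (Φ k (x k) - Φ k xmin) ≤ M := by
      have : 0 ≤ ‖z k - xmin‖ ^ 2 / (2 * s) := by positivity
      have h := hM k hk
      simp only [E] at h
      linarith
    have hεt : t (k - 1) ^ 2 * ε k ≤ S := by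
      refine le_trans ?_ (hS k hk1)
      have := htpos (k - 1)
      gcongr
      exact htmono.monotone (Nat.sub_le k 1)
    have h1 := mul_le_mul_of_nonneg_left hgap (sq_nonneg (t (k - 1)))
    have h2 := mul_le_mul_of_nonneg_right hεt (by positivity : 0 ≤ ‖xmin‖ ^ 2 / 2)
    have h3 : Φ k (x k) - Φ k (xbar k)
        ≤ (|M| + S * (‖xmin‖ ^ 2 / 2) + 1) / t (k - 1) ^ 2 := by
      rw [le_div_iff₀ (pow_pos (htpos _) 2)]
      linarith [le_abs_self M]
    linarith
  refine ⟨|M| + S * (‖xmin‖ ^ 2 / 2) + 1, ‖xmin‖ ^ 2 / 2 + 1, by positivity, by positivity, N,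
    fun k hk => ⟨?_, ?_⟩⟩
  · rw [hFreal k _ (hxD k (by omega)), hFreal k _ (hbarD k), ← EReal.coe_add]
    exact EReal.coe_le_coe_iff.2 (hrate k hk)
  · have hεk := hε_pos k (by omega)
    have hbar : Φ k (xbar k) ≤ Φ k xmin := by
      have h := hxbar k xmin
      rw [hFreal k _ (hbarD k), hFreal k _ hqD] at h
      exact EReal.coe_le_coe_iff.1 h
    have hr := hrate k hk
    have hnn : 0 ≤ ε k / 2 * ‖x k‖ ^ 2 := by positivity
    rw [hφ _ (hxD k (by omega)), hφ _ hqD, ← EReal.coe_add, ← EReal.coe_add, ← EReal.coe_add]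
    refine EReal.coe_le_coe_iff.2 ?_
    simp only [Φ] at hbar hr
    linarith
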